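/- Let ω₀ > 0, K > 0, H* ≥ 0, γ > 0, and let (q₀, p₀) ∈ ℝ² × ℝ² satisfy (q₀, p₀) ≠ (0, 0) and H(q₀, p₀) ≠ H*. Then there exists a locally Lipschitz function (q, p) : [0, ∞) → ℝ² × ℝ² with (q(0), p(0)) = (q₀, p₀) that is bounded on [0, ∞), satisfies for almost every t ≥ 0 the closed-loop equations q̇(t) = p(t), ṗ(t) = −ω₀²(1 + K(q₁(t)² + q₂(t)²))q(t) − γ sgn(H(q(t), p(t)) − H*) p(t), and satisfies H(q(t), p(t)) → H* as t → ∞. Moreover, if H* ≠ 0, then there exists T > 0 such that H(q(t), p(t)) → H* as t → T, i.e. the energy level H* is reached in finite time. -/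

import Mathlib

open Filter Topology MeasureTheory

/-- The Hamiltonian of the vibrating string:
`H(q, p) = ½(p₁² + p₂²) + (ω₀²/2)(q₁² + q₂²) + (ω₀²K/4)(q₁² + q₂²)²`. -/
noncomputable def Hstring (ω₀ K : ℝ) (q p : ℝ × ℝ) : ℝ :=
  (1 / 2) * (p.1 ^ 2 + p.2 ^ 2) + (ω₀ ^ 2 / 2) * (q.1 ^ 2 + q.2 ^ 2)
    + (ω₀ ^ 2 * K / 4) * (q.1 ^ 2 + q.2 ^ 2) ^ 2

theorem aux_global {E : Type*} [NormedAddCommGroup E] [NormedSpace ℝ E] [CompleteSpace E]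
    (f : E → E) (C L : NNReal) (hf : LipschitzWith C f) (hL : ∀ x, ‖f x‖ ≤ L) (x₀ : E) :
    ∃ α : ℝ → E, α 0 = x₀ ∧ ∀ t, HasDerivAt α (f (α t)) t := by
  have key : ∀ n : ℕ, ∃ α : ℝ → E, α 0 = x₀ ∧
      ∀ t ∈ Set.Ioo (-((n : ℝ) + 1)) ((n : ℝ) + 1), HasDerivAt α (f (α t)) t := by
    intro n
    have hn : (0 : ℝ) ≤ n := Nat.cast_nonneg n
    have h0 : (0 : ℝ) ∈ Set.Icc (-((n : ℝ) + 1)) ((n : ℝ) + 1) := ⟨by linarith, by linarith⟩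
    have hpl : IsPicardLindelof (fun _ => f) (⟨0, h0⟩ : Set.Icc (-((n : ℝ) + 1)) ((n : ℝ) + 1)) x₀
        (L * ((n : NNReal) + 1)) 0 L C := by
      refine ⟨fun t _ => hf.lipschitzOnWith, fun x _ => continuousOn_const,
        fun t _ x _ => hL x, ?_⟩
      simp
    obtain ⟨α, h1, h2⟩ := hpl.exists_eq_forall_mem_Icc_hasDerivWithinAt₀
    exact ⟨α, h1, fun t ht => (h2 t (Set.Ioo_subset_Icc_self ht)).hasDerivAt
      (Icc_mem_nhds ht.1 ht.2)⟩
  choose α hα0 hα using key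
  have huniq : ∀ m n : ℕ, m ≤ n →
      Set.EqOn (α m) (α n) (Set.Ioo (-((m : ℝ) + 1)) ((m : ℝ) + 1)) := by
    intro m n hmn
    have hm : (0 : ℝ) ≤ m := Nat.cast_nonneg m
    have hmn' : (m : ℝ) ≤ n := Nat.cast_le.mpr hmn
    refine ODE_solution_unique_of_mem_Ioo (v := fun _ => f) (s := fun _ => Set.univ) (K := C)
      (t₀ := 0) (fun t _ => hf.lipschitzOnWith) ⟨by linarith, by linarith⟩
      (fun t ht => ⟨hα m t ht, trivial⟩)
      (fun t ht => ⟨hα n t ⟨by linarith [ht.1], by linarith [ht.2]⟩, trivial⟩) ?_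
    rw [hα0, hα0]
  have hmem : ∀ t : ℝ, t ∈ Set.Ioo (-((⌈|t|⌉₊ : ℝ) + 1)) ((⌈|t|⌉₊ : ℝ) + 1) := by
    intro t
    have := Nat.le_ceil |t|
    have h1 := neg_abs_le t
    have h2 := le_abs_self t
    exact ⟨by linarith, by linarith⟩
  have heq : ∀ (n : ℕ) (t : ℝ), t ∈ Set.Ioo (-((n : ℝ) + 1)) ((n : ℝ) + 1) →
      α ⌈|t|⌉₊ t = α n t := by
    intro n t ht
    rcases le_total n ⌈|t|⌉₊ with h | h
    · exact (huniq _ _ h ht).symm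
    · exact huniq _ _ h (hmem t)
  refine ⟨fun t => α ⌈|t|⌉₊ t, ?_, ?_⟩
  · simp [hα0]
  · intro t
    have := hα ⌈|t|⌉₊ t (hmem t)
    refine this.congr_of_eventuallyEq ?_
    filter_upwards [Ioo_mem_nhds (hmem t).1 (hmem t).2] with s hs
    exact heq _ _ hs

theorem aux_norm_bound (ω₀ K : ℝ) (hω₀ : 0 < ω₀) (hK : 0 < K) (B : ℝ) :
    ∃ M : ℝ, ∀ q p : ℝ × ℝ, Hstring ω₀ K q p ≤ B → ‖q‖ ≤ M ∧ ‖p‖ ≤ M := by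
  refine ⟨1 + 2 * |B| + 2 * |B| / ω₀ ^ 2, ?_⟩
  intro q p h
  unfold Hstring at h
  have hB := le_abs_self B
  have hB0 := abs_nonneg B
  have hw : 0 < ω₀ ^ 2 := by positivity
  have h4 : 0 ≤ (ω₀ ^ 2 * K / 4) * (q.1 ^ 2 + q.2 ^ 2) ^ 2 := by positivity
  have hd : 0 ≤ 2 * |B| / ω₀ ^ 2 := by positivity
  have hq : q.1 ^ 2 + q.2 ^ 2 ≤ 2 * |B| / ω₀ ^ 2 := by
    rw [le_div_iff₀ hw]
    nlinarith [sq_nonneg p.1, sq_nonneg p.2]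
  have hp : p.1 ^ 2 + p.2 ^ 2 ≤ 2 * |B| := by
    nlinarith [mul_nonneg hw.le (add_nonneg (sq_nonneg q.1) (sq_nonneg q.2))]
  have aux : ∀ x : ℝ, |x| ≤ 1 + x ^ 2 := by
    intro x
    rw [abs_le]
    constructor <;> nlinarith [sq_nonneg (x + 1), sq_nonneg (x - 1)]
  constructor
  · rw [Prod.norm_def, max_le_iff, Real.norm_eq_abs, Real.norm_eq_abs]
    constructor
    · linarith [aux q.1, sq_nonneg q.2]
    · linarith [aux q.2, sq_nonneg q.1]
  · rw [Prod.norm_def, max_le_iff, Real.norm_eq_abs, Real.norm_eq_abs]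
    constructor
    · linarith [aux p.1, sq_nonneg p.2]
    · linarith [aux p.2, sq_nonneg p.1]

theorem aux_flow (ω₀ K : ℝ) (hω₀ : 0 < ω₀) (hK : 0 < K) (R d : ℝ) (q₀ p₀ : ℝ × ℝ) :
    ∃ (q p : ℝ → ℝ × ℝ) (χ : ℝ → ℝ) (C : NNReal), q 0 = q₀ ∧ p 0 = p₀ ∧
      LipschitzWith C q ∧ LipschitzWith C p ∧ (∀ t, 0 ≤ χ t) ∧
      (∀ t, Hstring ω₀ K (q t) (p t) ≤ R → χ t = 1) ∧
      (∀ t, HasDerivAt q (χ t • p t) t) ∧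
      (∀ t, HasDerivAt p (χ t • ((-(ω₀ ^ 2) * (1 + K * ((q t).1 ^ 2 + (q t).2 ^ 2))) • q t
            - d • p t)) t) := by
  let X : (ℝ × ℝ) × (ℝ × ℝ) → ℝ := fun z => Real.smoothTransition (R + 1 - Hstring ω₀ K z.1 z.2)
  let F : (ℝ × ℝ) × (ℝ × ℝ) → (ℝ × ℝ) × (ℝ × ℝ) := fun z =>
    X z • (z.2, (-(ω₀ ^ 2) * (1 + K * (z.1.1 ^ 2 + z.1.2 ^ 2))) • z.1 - d • z.2)
  have hX : ContDiff ℝ 1 X := by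
    refine Real.smoothTransition.contDiff.comp ?_
    unfold Hstring
    fun_prop
  have hF : ContDiff ℝ 1 F := by
    refine hX.smul ?_
    fun_prop
  obtain ⟨M, hM⟩ := aux_norm_bound ω₀ K hω₀ hK (R + 1)
  have hFc : HasCompactSupport F := by
    refine HasCompactSupport.of_support_subset_isCompact (isCompact_closedBall 0 M) ?_
    intro z hz
    rw [mem_closedBall_zero_iff]
    have hle : Hstring ω₀ K z.1 z.2 ≤ R + 1 := by
      by_contra hcon
      apply hz
      have : X z = 0 := Real.smoothTransition.zero_of_nonpos (by linarith)
      simp [F, this]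
    have := hM _ _ hle
    rw [Prod.norm_def]
    exact max_le this.1 this.2
  obtain ⟨C, hC⟩ := ContDiff.lipschitzWith_of_hasCompactSupport hFc hF one_ne_zero
  obtain ⟨L, hL⟩ := hFc.exists_bound_of_continuous hF.continuous
  have hL0 : 0 ≤ L := (norm_nonneg _).trans (hL 0)
  obtain ⟨α, hα0, hα⟩ := aux_global F C ⟨L, hL0⟩ hC hL (q₀, p₀)
  have hlip : LipschitzWith ⟨L, hL0⟩ α := by
    refine lipschitzWith_of_nnnorm_deriv_le (fun t => (hα t).differentiableAt) ?_
    intro t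
    rw [(hα t).deriv]
    exact hL _
  refine ⟨fun t => (α t).1, fun t => (α t).2, fun t => X (α t), 1 * ⟨L, hL0⟩, by simp [hα0],
    by simp [hα0], ?_, ?_, fun t => Real.smoothTransition.nonneg _, ?_, ?_, ?_⟩
  · have h := LipschitzWith.prod_fst.comp hlip
    exact h
  · have h := LipschitzWith.prod_snd.comp hlip
    exact h
  · intro t ht
    exact Real.smoothTransition.one_of_one_le (by linarith)
  · intro t
    exact (hα t).fst
  · intro t
    exact (hα t).snd

theorem aux_fst {f : ℝ → ℝ × ℝ} {f' : ℝ × ℝ} {t : ℝ} (h : HasDerivAt f f' t) :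
    HasDerivAt (fun t => (f t).1) f'.1 t := h.fst

theorem aux_snd {f : ℝ → ℝ × ℝ} {f' : ℝ × ℝ} {t : ℝ} (h : HasDerivAt f f' t) :
    HasDerivAt (fun t => (f t).2) f'.2 t := h.snd

theorem aux_Hderiv (ω₀ K d c t : ℝ) (q p : ℝ → ℝ × ℝ)
    (hq : HasDerivAt q (c • p t) t)
    (hp : HasDerivAt p (c • ((-(ω₀ ^ 2) * (1 + K * ((q t).1 ^ 2 + (q t).2 ^ 2))) • q t
            - d • p t)) t) :
    HasDerivAt (fun t => Hstring ω₀ K (q t) (p t)) (-(c * (d * ((p t).1 ^ 2 + (p t).2 ^ 2)))) t := by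
  have h1 := aux_fst hq
  have h2 := aux_snd hq
  have h3 := aux_fst hp
  have h4 := aux_snd hp
  have hr := (h1.pow 2).add (h2.pow 2)
  have := ((((h3.pow 2).add (h4.pow 2)).const_mul (1 / 2)).add (hr.const_mul (ω₀ ^ 2 / 2))).add
    ((hr.pow 2).const_mul (ω₀ ^ 2 * K / 4))
  refine (this.congr_deriv ?_)
  simp
  ring

theorem aux_bderiv (ω₀ K d c t : ℝ) (q p : ℝ → ℝ × ℝ)
    (hq : HasDerivAt q (c • p t) t)
    (hp : HasDerivAt p (c • ((-(ω₀ ^ 2) * (1 + K * ((q t).1 ^ 2 + (q t).2 ^ 2))) • q t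
            - d • p t)) t) :
    HasDerivAt (fun t => (q t).1 * (p t).1 + (q t).2 * (p t).2)
      (c * ((p t).1 ^ 2 + (p t).2 ^ 2
        - ω₀ ^ 2 * (1 + K * ((q t).1 ^ 2 + (q t).2 ^ 2)) * ((q t).1 ^ 2 + (q t).2 ^ 2)
        - d * ((q t).1 * (p t).1 + (q t).2 * (p t).2))) t := by
  have h1 := aux_fst hq
  have h2 := aux_snd hq
  have h3 := aux_fst hp
  have h4 := aux_snd hp
  have := (h1.mul h3).add (h2.mul h4)
  refine (this.congr_deriv ?_)
  simp
  ring

theorem aux_alg (ω₀ K γ : ℝ) (hω₀ : 0 < ω₀) (hK : 0 < K) (hγ : 0 < γ) :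
    ∃ ε : ℝ, 0 < ε ∧ ∀ q p : ℝ × ℝ,
      |ε * (q.1 * p.1 + q.2 * p.2)| ≤ Hstring ω₀ K q p / 2 ∧
      ε * Hstring ω₀ K q p + |ε * γ * (q.1 * p.1 + q.2 * p.2)| ≤
        (γ - ε) * (p.1 ^ 2 + p.2 ^ 2)
        + ε * (ω₀ ^ 2 * (1 + K * (q.1 ^ 2 + q.2 ^ 2)) * (q.1 ^ 2 + q.2 ^ 2)) := by
  obtain ⟨ε, h0, h1, h2⟩ : ∃ ε : ℝ, 0 < ε ∧ ε ≤ ω₀ / 2 ∧ ε * (2 * ω₀ ^ 2 + γ ^ 2) ≤ γ * ω₀ ^ 2 / 2 := by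
    refine ⟨min (ω₀ / 2) (γ * ω₀ ^ 2 / 2 / (2 * ω₀ ^ 2 + γ ^ 2)), by positivity, min_le_left _ _, ?_⟩
    rw [← le_div_iff₀ (by positivity)]
    exact min_le_right _ _
  refine ⟨ε, h0, ?_⟩
  intro q p
  obtain ⟨a, b⟩ := q
  obtain ⟨x, y⟩ := p
  simp only [Hstring]
  have hw : 0 < ω₀ ^ 2 := by positivity
  have hs : 0 ≤ a ^ 2 + b ^ 2 := by positivity
  have hx : 0 ≤ x ^ 2 + y ^ 2 := by positivity
  have hk : 0 ≤ ω₀ ^ 2 * K * (a ^ 2 + b ^ 2) ^ 2 := by positivity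
  have hb : |ω₀ * (a * x + b * y)| ≤ (ω₀ ^ 2 * (a ^ 2 + b ^ 2) + (x ^ 2 + y ^ 2)) / 2 := by
    rw [abs_le]
    constructor <;> nlinarith [sq_nonneg (ω₀ * a - x), sq_nonneg (ω₀ * a + x),
      sq_nonneg (ω₀ * b - y), sq_nonneg (ω₀ * b + y)]
  constructor
  · have : |ε * (a * x + b * y)| ≤ |ω₀ * (a * x + b * y)| / 2 := by
      rw [abs_mul, abs_mul, abs_of_pos h0, abs_of_pos hω₀]
      nlinarith [abs_nonneg (a * x + b * y)]
    nlinarith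
  · have hc : |γ * (a * x + b * y)| ≤ ω₀ ^ 2 / 2 * (a ^ 2 + b ^ 2)
        + γ ^ 2 / (2 * ω₀ ^ 2) * (x ^ 2 + y ^ 2) := by
      have e : ∀ u v : ℝ, |γ * (u * v)| ≤ ω₀ ^ 2 / 2 * u ^ 2 + γ ^ 2 / (2 * ω₀ ^ 2) * v ^ 2 := by
        intro u v
        have i1 : ω₀ ^ 2 / 2 * u ^ 2 + γ ^ 2 / (2 * ω₀ ^ 2) * v ^ 2 - γ * (u * v)
          = (ω₀ * u - γ / ω₀ * v) ^ 2 / 2 := by field_simp; ring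
        have i2 : ω₀ ^ 2 / 2 * u ^ 2 + γ ^ 2 / (2 * ω₀ ^ 2) * v ^ 2 + γ * (u * v)
          = (ω₀ * u + γ / ω₀ * v) ^ 2 / 2 := by field_simp; ring
        rw [abs_le]
        constructor
        · nlinarith [sq_nonneg (ω₀ * u + γ / ω₀ * v)]
        · nlinarith [sq_nonneg (ω₀ * u - γ / ω₀ * v)]
      have e1 := e a x
      have e2 := e b y
      have e3 := abs_add_le (γ * (a * x)) (γ * (b * y))
      rw [mul_add]
      linarith
    have hd : ε * (γ ^ 2 / (2 * ω₀ ^ 2)) + 3 / 2 * ε ≤ γ := by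
      have : ε * (γ ^ 2 / (2 * ω₀ ^ 2)) + ε = ε * (2 * ω₀ ^ 2 + γ ^ 2) / (2 * ω₀ ^ 2) := by
        field_simp
        ring
      have h3 : ε * (2 * ω₀ ^ 2 + γ ^ 2) / (2 * ω₀ ^ 2) ≤ γ / 4 := by
        rw [div_le_iff₀ (by positivity)]
        linarith
      have h4 : 0 ≤ ε * (γ ^ 2 / (2 * ω₀ ^ 2)) := by positivity
      linarith
    rw [mul_assoc, abs_mul, abs_of_pos h0]
    have h5 := mul_le_mul_of_nonneg_left hc h0.le
    have h6 := mul_le_mul_of_nonneg_right hd hx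
    have h7 := mul_nonneg h0.le hk
    nlinarith

theorem aux_exp (v v' : ℝ → ℝ) (c : ℝ) (hv : ∀ t, HasDerivAt v (v' t) t)
    (h : ∀ t, 0 ≤ t → v' t ≤ -c * v t) : ∀ t, 0 ≤ t → v t ≤ v 0 * Real.exp (-c * t) := by
  have hd : ∀ t, HasDerivAt (fun t => v t * Real.exp (c * t))
      (v' t * Real.exp (c * t) + v t * (Real.exp (c * t) * (c * 1))) t := fun t =>
    (hv t).mul (((hasDerivAt_id t).const_mul c).exp)
  have hanti : AntitoneOn (fun t => v t * Real.exp (c * t)) (Set.Ici 0) := by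
    refine antitoneOn_of_deriv_nonpos (convex_Ici 0)
      (fun t _ => (hd t).continuousAt.continuousWithinAt)
      (fun t _ => (hd t).differentiableAt.differentiableWithinAt) ?_
    intro t ht
    rw [interior_Ici] at ht
    rw [(hd t).deriv]
    have := h t (le_of_lt ht)
    have he := Real.exp_pos (c * t)
    nlinarith
  intro t ht
  have := hanti Set.self_mem_Ici ht ht
  simp only [mul_zero, Real.exp_zero, mul_one] at this
  calc v t = (v t * Real.exp (c * t)) * Real.exp (-c * t) := by
        rw [mul_assoc, ← Real.exp_add]; simp
    _ ≤ _ := mul_le_mul_of_nonneg_right this (Real.exp_pos _).le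

/-- gluing the controlled arc with a free motion at the level `H*` -/
theorem aux_glue (ω₀ K Hstar γ : ℝ) (hω₀ : 0 < ω₀) (hK : 0 < K)
    (q₁ p₁ : ℝ → ℝ × ℝ) (C : NNReal) (hq1 : LipschitzWith C q₁) (hp1 : LipschitzWith C p₁)
    (T B : ℝ) (hT : 0 < T) (hHT : Hstring ω₀ K (q₁ T) (p₁ T) = Hstar)
    (hB : ∀ t, 0 ≤ t → t ≤ T → Hstring ω₀ K (q₁ t) (p₁ t) ≤ B)
    (hode : ∀ t, 0 < t → t < T → HasDerivAt q₁ (p₁ t) t ∧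
        HasDerivAt p₁
          ((-(ω₀ ^ 2) * (1 + K * ((q₁ t).1 ^ 2 + (q₁ t).2 ^ 2))) • q₁ t
            - (γ * Real.sign (Hstring ω₀ K (q₁ t) (p₁ t) - Hstar)) • p₁ t) t) :
    ∃ q p : ℝ → ℝ × ℝ,
      LocallyLipschitz q ∧ LocallyLipschitz p ∧ q 0 = q₁ 0 ∧ p 0 = p₁ 0 ∧
      (∃ M : ℝ, ∀ t : ℝ, 0 ≤ t → ‖q t‖ ≤ M ∧ ‖p t‖ ≤ M) ∧
      (∀ᵐ t ∂(volume.restrict (Set.Ici (0 : ℝ))),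
        HasDerivAt q (p t) t ∧
        HasDerivAt p
          ((-(ω₀ ^ 2) * (1 + K * ((q t).1 ^ 2 + (q t).2 ^ 2))) • q t
            - (γ * Real.sign (Hstring ω₀ K (q t) (p t) - Hstar)) • p t) t) ∧
      Tendsto (fun t => Hstring ω₀ K (q t) (p t)) atTop (𝓝 Hstar) ∧
      (Hstar ≠ 0 → ∃ T : ℝ, 0 < T ∧
        Tendsto (fun t => Hstring ω₀ K (q t) (p t)) (𝓝 T) (𝓝 Hstar)) := by
  obtain ⟨q₂, p₂, χ, C₂, hq20, hp20, hq2, hp2, -, hχ1, hdq, hdp⟩ :=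
    aux_flow ω₀ K hω₀ hK Hstar 0 (q₁ T) (p₁ T)
  have hH2 : ∀ t, Hstring ω₀ K (q₂ t) (p₂ t) = Hstar := by
    have hder : ∀ t, HasDerivAt (fun t => Hstring ω₀ K (q₂ t) (p₂ t)) 0 t := fun t =>
      (aux_Hderiv ω₀ K 0 (χ t) t q₂ p₂ (hdq t) (hdp t)).congr_deriv (by simp)
    intro t
    have := is_const_of_deriv_eq_zero (fun t => (hder t).differentiableAt)
      (fun t => (hder t).deriv) t 0
    simp only [hq20, hp20, hHT] at this
    exact this
  have hl1 : LipschitzWith 1 (fun t : ℝ => min (max t 0) T) :=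
    (LipschitzWith.id.max_const 0).min_const T
  have hl2 : LipschitzWith 1 (fun t : ℝ => max (t - T) 0) := by
    have : LipschitzWith 1 (fun t : ℝ => t - T) := by
      refine LipschitzWith.of_dist_le_mul ?_
      intro x y
      simp
    exact this.max_const 0
  let J : (ℝ → ℝ × ℝ) → (ℝ → ℝ × ℝ) → ℝ → ℝ × ℝ := fun f g t =>
    f (min (max t 0) T) + g (max (t - T) 0) - f T
  have hJlip : ∀ f g : ℝ → ℝ × ℝ, LipschitzWith C f → LipschitzWith C₂ g →
      LocallyLipschitz (J f g) := by
    intro f g hf hg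
    have := ((hf.comp hl1).add (hg.comp hl2)).sub (LipschitzWith.const (f T))
    exact this.locallyLipschitz
  have hJ1 : ∀ f g : ℝ → ℝ × ℝ, g 0 = f T → ∀ t, 0 ≤ t → t ≤ T → J f g t = f t := by
    intro f g hfg t h0 h1
    simp only [J]
    rw [max_eq_left h0, min_eq_left h1, max_eq_right (by linarith : t - T ≤ 0), hfg]
    simp
  have hJ2 : ∀ f g : ℝ → ℝ × ℝ, ∀ t, T ≤ t → J f g t = g (t - T) := by
    intro f g t h1
    simp only [J]
    rw [max_eq_left (hT.le.trans h1), min_eq_right h1, max_eq_left (by linarith : 0 ≤ t - T)]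
    simp
  have hHJ : ∀ t, T ≤ t → Hstring ω₀ K (J q₁ q₂ t) (J p₁ p₂ t) = Hstar := by
    intro t ht
    rw [hJ2 _ _ _ ht, hJ2 _ _ _ ht, hH2]
  obtain ⟨M, hM⟩ := aux_norm_bound ω₀ K hω₀ hK (max B Hstar)
  refine ⟨J q₁ q₂, J p₁ p₂, hJlip _ _ hq1 hq2, hJlip _ _ hp1 hp2,
    hJ1 _ _ hq20 0 le_rfl hT.le, hJ1 _ _ hp20 0 le_rfl hT.le, ⟨M, ?_⟩, ?_, ?_, ?_⟩
  · intro t ht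
    apply hM
    rcases le_total t T with h | h
    · rw [hJ1 _ _ hq20 t ht h, hJ1 _ _ hp20 t ht h]
      exact (hB t ht h).trans (le_max_left _ _)
    · rw [hHJ t h]
      exact le_max_right _ _
  · rw [ae_restrict_iff' measurableSet_Ici]
    have hne0 : ∀ᵐ t : ℝ, t ≠ 0 := by simp [ae_iff]
    have hneT : ∀ᵐ t : ℝ, t ≠ T := by simp [ae_iff]
    filter_upwards [hne0, hneT] with t h0 h1 h2
    have h0' : 0 < t := lt_of_le_of_ne h2 (Ne.symm h0)
    rcases lt_or_gt_of_ne h1 with h | h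
    · have ev : ∀ f g : ℝ → ℝ × ℝ, g 0 = f T → J f g =ᶠ[𝓝 t] f := by
        intro f g hfg
        filter_upwards [Ioo_mem_nhds h0' h] with s hs
        exact hJ1 f g hfg s hs.1.le hs.2.le
      rw [hJ1 _ _ hq20 t h0'.le h.le, hJ1 _ _ hp20 t h0'.le h.le]
      obtain ⟨a, b⟩ := hode t h0' h
      exact ⟨a.congr_of_eventuallyEq (ev _ _ hq20), b.congr_of_eventuallyEq (ev _ _ hp20)⟩
    · have ev : ∀ f g : ℝ → ℝ × ℝ, J f g =ᶠ[𝓝 t] fun s => g (s - T) := by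
        intro f g
        filter_upwards [Ioi_mem_nhds h] with s hs
        exact hJ2 f g s (le_of_lt hs)
      rw [hHJ t h.le, hJ2 _ _ t h.le, hJ2 _ _ t h.le]
      have a := (hdq (t - T)).comp_sub_const t T
      have b := (hdp (t - T)).comp_sub_const t T
      rw [hχ1 _ (hH2 _).le, one_smul] at a b
      simp only [sub_self, Real.sign_zero, mul_zero]
      exact ⟨a.congr_of_eventuallyEq (ev _ _), b.congr_of_eventuallyEq (ev _ _)⟩
  · refine tendsto_const_nhds.congr' ?_
    filter_upwards [eventually_ge_atTop T] with t ht
    exact (hHJ t ht).symm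
  · intro _
    refine ⟨T + 1, by linarith, tendsto_const_nhds.congr' ?_⟩
    filter_upwards [Ioi_mem_nhds (by linarith : T < T + 1)] with t ht
    exact (hHJ t (le_of_lt ht)).symm

theorem aux_first (h : ℝ → ℝ) (hc : Continuous h) (c t₁ : ℝ) (h0 : h 0 ≠ c) (ht : 0 ≤ t₁)
    (h1 : h t₁ = c) : ∃ T, 0 < T ∧ h T = c ∧ ∀ t, 0 ≤ t → t < T → h t ≠ c := by
  have hcomp : IsCompact (Set.Icc 0 t₁ ∩ h ⁻¹' {c}) :=
    isCompact_Icc.inter_right (isClosed_singleton.preimage hc)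
  obtain ⟨T, hT, hl⟩ := hcomp.exists_isLeast ⟨t₁, ⟨ht, le_rfl⟩, h1⟩
  refine ⟨T, lt_of_le_of_ne hT.1.1 ?_, hT.2, ?_⟩
  · intro h2
    apply h0
    rw [h2]
    exact hT.2
  · intro t ht0 htT hh
    exact absurd (hl ⟨⟨ht0, htT.le.trans hT.1.2⟩, hh⟩) (not_le.mpr htT)

/-- Energy control of the vibrating string by the nonsmooth speed-gradient feedback
`u = −γ sgn(H − H*) p`: for every nonzero initial state whose energy differs from `H*`,
there is a bounded, locally Lipschitz solution of the closed-loop system defined on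
`[0, ∞)` along which the energy tends to `H*`; moreover, if `H* ≠ 0`, the energy level
`H*` is reached in finite time. -/
theorem string_energy_control
    (ω₀ K Hstar γ : ℝ) (hω₀ : 0 < ω₀) (hK : 0 < K) (hHstar : 0 ≤ Hstar) (hγ : 0 < γ)
    (q₀ p₀ : ℝ × ℝ) (h0 : (q₀, p₀) ≠ ((0 : ℝ × ℝ), (0 : ℝ × ℝ)))
    (hH0 : Hstring ω₀ K q₀ p₀ ≠ Hstar) :
    ∃ q p : ℝ → ℝ × ℝ,
      LocallyLipschitz q ∧ LocallyLipschitz p ∧ q 0 = q₀ ∧ p 0 = p₀ ∧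
      (∃ M : ℝ, ∀ t : ℝ, 0 ≤ t → ‖q t‖ ≤ M ∧ ‖p t‖ ≤ M) ∧
      (∀ᵐ t ∂(volume.restrict (Set.Ici (0 : ℝ))),
        HasDerivAt q (p t) t ∧
        HasDerivAt p
          ((-(ω₀ ^ 2) * (1 + K * ((q t).1 ^ 2 + (q t).2 ^ 2))) • q t
            - (γ * Real.sign (Hstring ω₀ K (q t) (p t) - Hstar)) • p t) t) ∧
      Tendsto (fun t => Hstring ω₀ K (q t) (p t)) atTop (𝓝 Hstar) ∧
      (Hstar ≠ 0 → ∃ T : ℝ, 0 < T ∧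
        Tendsto (fun t => Hstring ω₀ K (q t) (p t)) (𝓝 T) (𝓝 Hstar)) := by
  have hHpos : 0 < Hstring ω₀ K q₀ p₀ := by
    by_contra hcon
    apply h0
    obtain ⟨a, b⟩ := q₀
    obtain ⟨x, y⟩ := p₀
    simp only [Hstring, not_lt] at hcon
    have hw : 0 < ω₀ ^ 2 := by positivity
    have h4 : 0 ≤ (ω₀ ^ 2 * K / 4) * (a ^ 2 + b ^ 2) ^ 2 := by positivity
    have h5 : 0 ≤ ω₀ ^ 2 / 2 * (a ^ 2 + b ^ 2) := by positivity
    have h6 : x ^ 2 + y ^ 2 = 0 := le_antisymm (by nlinarith) (by positivity)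
    have h7 : ω₀ ^ 2 / 2 * (a ^ 2 + b ^ 2) = 0 := le_antisymm (by nlinarith) h5
    have h8 : a ^ 2 + b ^ 2 = 0 := by
      rcases mul_eq_zero.mp h7 with h | h
      · linarith
      · exact h
    have e1 : x = 0 := by nlinarith [sq_nonneg x, sq_nonneg y]
    have e2 : y = 0 := by nlinarith [sq_nonneg x, sq_nonneg y]
    have e3 : a = 0 := by nlinarith [sq_nonneg a, sq_nonneg b]
    have e4 : b = 0 := by nlinarith [sq_nonneg a, sq_nonneg b]
    simp [e1, e2, e3, e4]
  obtain ⟨ε, hε, halg⟩ := aux_alg ω₀ K γ hω₀ hK hγ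
  have hHc : ∀ q p : ℝ → ℝ × ℝ, Continuous q → Continuous p →
      Continuous (fun t => Hstring ω₀ K (q t) (p t)) := by
    intro q p hq hp
    unfold Hstring
    fun_prop
  rcases lt_or_gt_of_ne hH0 with hlt | hgt
  · -- energy must be pumped in
    obtain ⟨q, p, χ, C, hq0, hp0, hq, hp, hχ0, hχ1, hdq, hdp⟩ :=
      aux_flow ω₀ K hω₀ hK Hstar (-γ) q₀ p₀
    have hH := fun t => aux_Hderiv ω₀ K (-γ) (χ t) t q p (hdq t) (hdp t)
    have hb := fun t => aux_bderiv ω₀ K (-γ) (χ t) t q p (hdq t) (hdp t)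
    have hcont := hHc q p hq.continuous hp.continuous
    have hmono : Monotone (fun t => Hstring ω₀ K (q t) (p t)) := by
      refine monotone_of_deriv_nonneg (fun t => (hH t).differentiableAt) ?_
      intro t
      rw [(hH t).deriv]
      have := hχ0 t
      have : 0 ≤ χ t * (γ * ((p t).1 ^ 2 + (p t).2 ^ 2)) := by positivity
      linarith
    have hreach : ∃ t, 0 ≤ t ∧ Hstar ≤ Hstring ω₀ K (q t) (p t) := by
      by_contra! hcon
      let b : ℝ → ℝ := fun t => (q t).1 * (p t).1 + (q t).2 * (p t).2
      have hexp := aux_exp (fun t => -(Hstring ω₀ K (q t) (p t) - ε * b t)) _ (-(ε / 2))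
        (fun t => ((hH t).sub ((hb t).const_mul ε)).neg) (by
          intro t ht
          rw [hχ1 t (hcon t ht).le]
          obtain ⟨g1, g2⟩ := halg (q t) (p t)
          have g3 := neg_abs_le (ε * γ * ((q t).1 * (p t).1 + (q t).2 * (p t).2))
          have g3' := le_abs_self (ε * γ * ((q t).1 * (p t).1 + (q t).2 * (p t).2))
          have g4 := mul_le_mul_of_nonneg_left ((abs_le.mp g1).1) hε.le
          have g5 := mul_le_mul_of_nonneg_left ((abs_le.mp g1).2) hε.le
          have g6 : 0 ≤ Hstring ω₀ K (q t) (p t) := by unfold Hstring; positivity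
          have g7 := mul_nonneg hε.le g6
          simp only [b]
          linarith)
      have htop : Tendsto (fun t : ℝ => Real.exp (-(-(ε / 2)) * t)) atTop atTop := by
        refine Real.tendsto_exp_atTop.comp ?_
        exact tendsto_id.const_mul_atTop (by linarith)
      obtain ⟨h1, -⟩ := halg q₀ p₀
      have hb0 := (abs_le.mp h1).2
      obtain ⟨t, ht0, ht⟩ := ((eventually_ge_atTop 0).and
        (htop.eventually_ge_atTop (4 * Hstar / Hstring ω₀ K q₀ p₀))).exists
      have e1 := hexp t ht0
      simp only [b, hq0, hp0] at e1
      have e2 := hcon t ht0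
      have e3 := (abs_le.mp (halg (q t) (p t)).1).1
      rw [div_le_iff₀ hHpos] at ht
      have e4 := Real.exp_pos (-(-(ε / 2)) * t)
      have hsp : 0 < Hstar := hHpos.trans hlt
      nlinarith
    obtain ⟨t₂, ht20, ht2⟩ := hreach
    have hstart : Hstring ω₀ K (q 0) (p 0) = Hstring ω₀ K q₀ p₀ := by rw [hq0, hp0]
    obtain ⟨t₁, ht1, hh1⟩ := intermediate_value_Icc ht20 hcont.continuousOn
      ⟨(hstart.le.trans hlt.le), ht2⟩
    obtain ⟨T, hT, hHT, hne⟩ := aux_first _ hcont Hstar t₁ (by simp only [hstart]; exact hH0) ht1.1 hh1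
    have hlt' : ∀ t, 0 ≤ t → t < T → Hstring ω₀ K (q t) (p t) < Hstar := fun t h1 h2 =>
      lt_of_le_of_ne ((hmono h2.le).trans hHT.le) (hne t h1 h2)
    have := aux_glue ω₀ K Hstar γ hω₀ hK q p C hq hp T Hstar hT hHT
      (fun t _ h2 => (hmono h2).trans hHT.le) (by
        intro t h1 h2
        have h3 := hlt' t h1.le h2
        have a := hdq t
        have b := hdp t
        rw [hχ1 t h3.le, one_smul] at a b
        rw [Real.sign_of_neg (by linarith), mul_neg_one]
        exact ⟨a, b⟩)
    rwa [hq0, hp0] at this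
  · -- energy must be dissipated
    obtain ⟨q, p, χ, C, hq0, hp0, hq, hp, hχ0, hχ1, hdq, hdp⟩ :=
      aux_flow ω₀ K hω₀ hK (Hstring ω₀ K q₀ p₀) γ q₀ p₀
    have hH := fun t => aux_Hderiv ω₀ K γ (χ t) t q p (hdq t) (hdp t)
    have hb := fun t => aux_bderiv ω₀ K γ (χ t) t q p (hdq t) (hdp t)
    have hcont := hHc q p hq.continuous hp.continuous
    have hanti : Antitone (fun t => Hstring ω₀ K (q t) (p t)) := by
      refine antitone_of_deriv_nonpos (fun t => (hH t).differentiableAt) ?_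
      intro t
      rw [(hH t).deriv]
      have := hχ0 t
      have : 0 ≤ χ t * (γ * ((p t).1 ^ 2 + (p t).2 ^ 2)) := by positivity
      linarith
    have hstart : Hstring ω₀ K (q 0) (p 0) = Hstring ω₀ K q₀ p₀ := by rw [hq0, hp0]
    have hle : ∀ t, 0 ≤ t → Hstring ω₀ K (q t) (p t) ≤ Hstring ω₀ K q₀ p₀ := fun t ht =>
      (hanti ht).trans hstart.le
    have hone : ∀ t, 0 ≤ t → χ t = 1 := fun t ht => hχ1 t (hle t ht)
    have hnn : ∀ t, 0 ≤ Hstring ω₀ K (q t) (p t) := by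
      intro t
      unfold Hstring
      positivity
    have hlim : Tendsto (fun t => Hstring ω₀ K (q t) (p t)) atTop (𝓝 0) := by
      let b : ℝ → ℝ := fun t => (q t).1 * (p t).1 + (q t).2 * (p t).2
      have hexp := aux_exp (fun t => Hstring ω₀ K (q t) (p t) + ε * b t) _ (ε / 2)
        (fun t => (hH t).add ((hb t).const_mul ε)) (by
          intro t ht
          rw [hone t ht]
          obtain ⟨g1, g2⟩ := halg (q t) (p t)
          have g3 := neg_abs_le (ε * γ * ((q t).1 * (p t).1 + (q t).2 * (p t).2))
          have g3' := le_abs_self (ε * γ * ((q t).1 * (p t).1 + (q t).2 * (p t).2))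
          have g4 := mul_le_mul_of_nonneg_left ((abs_le.mp g1).1) hε.le
          have g5 := mul_le_mul_of_nonneg_left ((abs_le.mp g1).2) hε.le
          have g7 := mul_nonneg hε.le (hnn t)
          simp only [b]
          linarith)
      have hz : Tendsto (fun t : ℝ => Real.exp (-(ε / 2) * t)) atTop (𝓝 0) := by
        refine Real.tendsto_exp_atBot.comp ?_
        exact tendsto_id.const_mul_atTop_of_neg (by linarith)
      have hz2 := hz.const_mul (2 * (Hstring ω₀ K (q 0) (p 0) + ε * b 0))
      rw [mul_zero] at hz2
      refine tendsto_of_tendsto_of_tendsto_of_le_of_le' tendsto_const_nhds hz2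
        (Eventually.of_forall hnn) ?_
      filter_upwards [eventually_ge_atTop 0] with t ht
      have e1 := hexp t ht
      have e3 := (abs_le.mp (halg (q t) (p t)).1).1
      simp only [b] at e1 ⊢
      linarith
    rcases hHstar.eq_or_lt with hz | hpos
    · -- target energy zero
      subst hz
      have hpos : ∀ t, 0 ≤ t → 0 < Hstring ω₀ K (q t) (p t) := by
        intro t ht
        have hexp := aux_exp (fun t => -(Hstring ω₀ K (q t) (p t))) _ (2 * γ)
          (fun t => (hH t).neg) (by
            intro t ht
            rw [hone t ht]
            have hw : 0 ≤ (ω₀ ^ 2 / 2) * ((q t).1 ^ 2 + (q t).2 ^ 2)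
              + (ω₀ ^ 2 * K / 4) * ((q t).1 ^ 2 + (q t).2 ^ 2) ^ 2 := by positivity
            have hw2 := mul_nonneg hγ.le hw
            unfold Hstring
            linarith) t ht
        simp only [hstart] at hexp
        have := mul_pos hHpos (Real.exp_pos (-(2 * γ) * t))
        linarith
      obtain ⟨M, hM⟩ := aux_norm_bound ω₀ K hω₀ hK (Hstring ω₀ K q₀ p₀)
      refine ⟨q, p, hq.locallyLipschitz, hp.locallyLipschitz, hq0, hp0,
        ⟨M, fun t ht => hM _ _ (hle t ht)⟩, ?_, hlim, fun h => absurd rfl h⟩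
      rw [ae_restrict_iff' measurableSet_Ici]
      refine Eventually.of_forall ?_
      intro t ht
      have a := hdq t
      have b := hdp t
      rw [hone t ht, one_smul] at a b
      rw [Real.sign_of_pos (by linarith [hpos t ht]), mul_one]
      exact ⟨a, b⟩
    · obtain ⟨t₂, ht20, ht2⟩ := ((eventually_ge_atTop 0).and
        (hlim.eventually (gt_mem_nhds hpos))).exists
      obtain ⟨t₁, ht1, hh1⟩ := intermediate_value_Icc' ht20 hcont.continuousOn
        ⟨ht2.le, (hgt.le.trans hstart.ge)⟩
      obtain ⟨T, hT, hHT, hne⟩ :=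
        aux_first _ hcont Hstar t₁ (by simp only [hstart]; exact hH0) ht1.1 hh1
      have hgt' : ∀ t, 0 ≤ t → t < T → Hstar < Hstring ω₀ K (q t) (p t) := fun t h1 h2 =>
        lt_of_le_of_ne (hHT.ge.trans (hanti h2.le)) (hne t h1 h2).symm
      have := aux_glue ω₀ K Hstar γ hω₀ hK q p C hq hp T (Hstring ω₀ K q₀ p₀) hT hHT
        (fun t h1 _ => hle t h1) (by
          intro t h1 h2
          have h3 := hgt' t h1.le h2
          have a := hdq t
          have b := hdp t
          rw [hone t h1.le, one_smul] at a b
          rw [Real.sign_of_pos (by linarith), mul_one]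
          exact ⟨a, b⟩)
      rwa [hq0, hp0] at this
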